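/- Let X_1, X_2, ... be independent and identically distributed real-valued random variables with common distribution function F, and let 0 < p_1 < ... < p_k < 1. Suppose F has a density f in neighbourhoods of ξ_{p_1},...,ξ_{p_k} and f is positive and continuous at each ξ_{p_i}. Let ξ̂_n = (ξ̂_{p_1,n},...,ξ̂_{p_k,n})' denote the vector of empirical quantiles and ξ = (ξ_{p_1},...,ξ_{p_k})'. Then √n(ξ̂_n − ξ) converges in distribution to a centered k-dimensional Gaussian distribution with covariance matrix Σ whose (i,j) entry is σ_{ij} = p_i(1−p_j)/(f(ξ_{p_i}) f(ξ_{p_j})) for i ≤ j and σ_{ij} = p_j(1−p_i)/(f(ξ_{p_i}) f(ξ_{p_j})) for i > j. -/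

import Mathlib

open MeasureTheory ProbabilityTheory Filter Topology

/-- The `p`-th quantile of a distribution function `F`: `inf {x | F x ≥ p}`. -/
noncomputable def quantileOf (F : ℝ → ℝ) (p : ℝ) : ℝ := sInf {x | p ≤ F x}

/-- Empirical distribution function of the first `n` observations of `X`. -/
noncomputable def empCDF {Ω : Type*} (X : ℕ → Ω → ℝ) (n : ℕ) (ω : Ω) (x : ℝ) : ℝ :=
  (n : ℝ)⁻¹ * ∑ j ∈ Finset.range n, if X j ω ≤ x then (1 : ℝ) else 0

/-- Empirical `p`-th quantile computed from the first `n` observations of `X`. -/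
noncomputable def empQuantile {Ω : Type*} (X : ℕ → Ω → ℝ) (n : ℕ) (p : ℝ) (ω : Ω) : ℝ :=
  quantileOf (empCDF X n ω) p

lemma aux_empCDF_mono {Ω : Type*} (X : ℕ → Ω → ℝ) (n : ℕ) (ω : Ω) :
    Monotone (empCDF X n ω) := by
  intro x y hxy
  unfold empCDF
  refine mul_le_mul_of_nonneg_left (Finset.sum_le_sum fun j _ => ?_) (by positivity)
  by_cases h : X j ω ≤ x
  · simp [h, h.trans hxy]
  · simp only [h, if_false]
    split_ifs <;> norm_num

lemma aux_switch {Ω : Type*} (X : ℕ → Ω → ℝ) (n : ℕ) (hn : n ≠ 0) (p : ℝ) (hp0 : 0 < p)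
    (hp1 : p < 1) (ω : Ω) (x : ℝ) :
    empQuantile X n p ω ≤ x ↔ p ≤ empCDF X n ω x := by
  have hmono := aux_empCDF_mono X n ω
  have hn' : (n : ℝ) ≠ 0 := by exact_mod_cast hn
  have hne : ∃ z, p ≤ empCDF X n ω z := by
    have : ∀ᶠ z in atTop, ∀ j ∈ Finset.range n, X j ω ≤ z := by
      rw [Filter.eventually_all_finset]
      exact fun j _ => eventually_ge_atTop _
    obtain ⟨z, hz⟩ := this.exists
    refine ⟨z, ?_⟩
    unfold empCDF
    rw [Finset.sum_congr rfl (fun j hj => if_pos (hz j hj))]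
    simp [hn']
    exact hp1.le
  have hbdd : BddBelow {z | p ≤ empCDF X n ω z} := by
    have : ∀ᶠ z in atBot, ∀ j ∈ Finset.range n, z < X j ω := by
      rw [Filter.eventually_all_finset]
      exact fun j _ => eventually_lt_atBot _
    obtain ⟨z, hz⟩ := this.exists
    refine ⟨z, fun y hy => ?_⟩
    by_contra! hyz
    have h1 := hmono hyz.le
    have h0 : empCDF X n ω z = 0 := by
      unfold empCDF
      rw [Finset.sum_congr rfl (fun j hj => if_neg (not_le.2 (hz j hj)))]
      simp
    have h2 : p ≤ empCDF X n ω y := hy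
    linarith
  constructor
  · intro h
    by_contra! hlt
    have hev : ∀ᶠ y in 𝓝[>] x, ∀ j ∈ Finset.range n, (X j ω ≤ y ↔ X j ω ≤ x) := by
      rw [Filter.eventually_all_finset]
      intro j _
      by_cases hj : X j ω ≤ x
      · filter_upwards [self_mem_nhdsWithin] with y hy
        exact ⟨fun _ => hj, fun _ => hj.trans (le_of_lt hy)⟩
      · filter_upwards [nhdsWithin_le_nhds (gt_mem_nhds (not_le.1 hj))] with y hy
        exact ⟨fun h => absurd hy (not_lt.2 h), fun h => absurd h hj⟩
    obtain ⟨y, hy, hxy⟩ := (hev.and self_mem_nhdsWithin).exists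
    have heq : empCDF X n ω y = empCDF X n ω x := by
      unfold empCDF
      congr 1
      refine Finset.sum_congr rfl fun j hj => ?_
      simp only [hy j hj]
    have : y ≤ empQuantile X n p ω := by
      refine le_csInf hne fun z hz => ?_
      by_contra! hzy
      have h1 := hmono hzy.le
      have h2 : p ≤ empCDF X n ω z := hz
      linarith
    have hxy' : x < y := hxy
    linarith
  · intro h
    exact csInf_le hbdd h

lemma aux_empCDF_meas {Ω : Type*} [MeasurableSpace Ω] (X : ℕ → Ω → ℝ)
    (hmeas : ∀ i, Measurable (X i)) (n : ℕ) (x : ℝ) :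
    Measurable (fun ω => empCDF X n ω x) := by
  unfold empCDF
  refine Measurable.const_mul (Finset.measurable_fun_sum _ fun j _ => ?_) _
  exact Measurable.ite (measurableSet_le (hmeas j) measurable_const) measurable_const
    measurable_const

lemma aux_empQuantile_meas {Ω : Type*} [MeasurableSpace Ω] (X : ℕ → Ω → ℝ)
    (hmeas : ∀ i, Measurable (X i)) (n : ℕ) (p : ℝ) (hp0 : 0 < p) (hp1 : p < 1) :
    Measurable (empQuantile X n p) := by
  rcases eq_or_ne n 0 with rfl | hn
  · have : empQuantile X 0 p = fun _ => sInf {_x : ℝ | p ≤ 0} := by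
      funext ω
      simp [empQuantile, quantileOf, empCDF]
    rw [this]
    exact measurable_const
  · refine measurable_of_Iic fun x => ?_
    have : empQuantile X n p ⁻¹' Set.Iic x = {ω | p ≤ empCDF X n ω x} := by
      ext ω
      exact aux_switch X n hn p hp0 hp1 ω x
    rw [this]
    exact measurableSet_le measurable_const (aux_empCDF_meas X hmeas n x)

lemma aux_deriv {Ω : Type*} [MeasurableSpace Ω] (P : Measure Ω) [IsProbabilityMeasure P]
    (X : Ω → ℝ) (hX : Measurable X) (F f : ℝ → ℝ)
    (hF : ∀ x, F x = (P {ω | X ω ≤ x}).toReal) (p : ℝ) (hp0 : 0 < p) (hp1 : p < 1)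
    (ξ : ℝ) (hξ : ξ = quantileOf F p)
    (hdens : ∃ U ∈ 𝓝 ξ, ∀ x ∈ U, F x = ∫ s in Set.Iic x, f s)
    (hfcont : ContinuousAt f ξ) : HasDerivAt F (f ξ) ξ ∧ F ξ = p := by
  have := Measure.isProbabilityMeasure_map (μ := P) hX.aemeasurable
  have hFc : F = cdf (P.map X) := by
    funext x
    rw [cdf_eq_real, hF, measureReal_def, Measure.map_apply hX measurableSet_Iic]
    rfl
  have hmono : Monotone F := by rw [hFc]; exact monotone_cdf _
  have hne : ∃ z, p ≤ F z := by
    have h := tendsto_cdf_atTop (P.map X)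
    rw [← hFc] at h
    obtain ⟨z, hz⟩ := (h.eventually (lt_mem_nhds hp1)).exists
    exact ⟨z, hz.le⟩
  have hbdd : BddBelow {z | p ≤ F z} := by
    have h := tendsto_cdf_atBot (P.map X)
    rw [← hFc] at h
    obtain ⟨z, hz⟩ := (h.eventually (gt_mem_nhds hp0)).exists
    refine ⟨z, fun y hy => ?_⟩
    by_contra! hyz
    have h1 := hmono hyz.le
    have h2 : p ≤ F y := hy
    linarith
  have hgt : ∀ x, ξ < x → p ≤ F x := by
    intro x hx
    rw [hξ] at hx
    obtain ⟨z, hz, hzx⟩ := (csInf_lt_iff hbdd hne).1 hx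
    exact le_trans hz (hmono hzx.le)
  have hlt : ∀ x, x < ξ → F x ≤ p := by
    intro x hx
    by_contra! h
    have : ξ ≤ x := by rw [hξ]; exact csInf_le hbdd h.le
    linarith
  obtain ⟨U, hU, hUF⟩ := hdens
  have hU2 : ∀ᶠ x in 𝓝[>] ξ, x ∈ U := nhdsWithin_le_nhds hU
  obtain ⟨x0, hx0U, hx0⟩ : ∃ x, x ∈ U ∧ ξ < x := (hU2.and self_mem_nhdsWithin).exists
  have hint : IntegrableOn f (Set.Iic x0) := by
    by_contra h
    have h1 := hUF x0 hx0U
    rw [integral_undef h] at h1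
    have := hgt x0 hx0
    linarith
  have hintx : ∀ x, x ≤ x0 → IntegrableOn f (Set.Iic x) :=
    fun x hx => hint.mono_set (Set.Iic_subset_Iic.2 hx)
  have hd : HasDerivAt (fun u => ∫ x in (ξ-1)..u, f x) (f ξ) ξ := by
    refine intervalIntegral.integral_hasDerivAt_right ?_ ?_ hfcont
    · rw [intervalIntegrable_iff_integrableOn_Ioc_of_le (by linarith)]
      exact (hintx ξ hx0.le).mono_set Set.Ioc_subset_Iic_self
    · exact ⟨Set.Iic x0, Iic_mem_nhds hx0, hint.aestronglyMeasurable⟩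
  have hd2 : HasDerivAt F (f ξ) ξ := by
    refine (hd.const_add (∫ s in Set.Iic (ξ-1), f s)).congr_of_eventuallyEq ?_
    filter_upwards [hU, Iic_mem_nhds hx0] with x hxU hx
    rw [hUF x hxU, ← intervalIntegral.integral_Iic_sub_Iic (hintx _ (by linarith)) (hintx x hx)]
    ring
  refine ⟨hd2, le_antisymm ?_ ?_⟩
  · refine le_of_tendsto (hd2.continuousAt.tendsto.mono_left (nhdsWithin_le_nhds (s := Set.Iio ξ))) ?_
    filter_upwards [self_mem_nhdsWithin] with x hx using hlt x hx
  · refine ge_of_tendsto (hd2.continuousAt.tendsto.mono_left (nhdsWithin_le_nhds (s := Set.Ioi ξ))) ?_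
    filter_upwards [self_mem_nhdsWithin] with x hx using hgt x hx

lemma aux_cheb {Ω : Type*} [MeasurableSpace Ω] (P : Measure Ω) [IsProbabilityMeasure P]
    (X : ℕ → Ω → ℝ) (hmeas : ∀ i, Measurable (X i))
    (hindep : iIndepFun X P)
    (hident : ∀ i, IdentDistrib (X i) (X 0) P P)
    (h : ℝ → ℝ) (hh : Measurable h) (hb : ∀ t, |h t| ≤ 1) (n : ℕ) (hn : n ≠ 0) (a : ℝ)
    (ha : 0 < a) :
    P {ω | a ≤ |√n * ((∫ ω, h (X 0 ω) ∂P) - (n : ℝ)⁻¹ * ∑ j ∈ Finset.range n, h (X j ω))|} ≤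
      ENNReal.ofReal ((∫ ω, (h (X 0 ω)) ^ 2 ∂P) / a ^ 2) := by
  have hn' : (n : ℝ) ≠ 0 := by exact_mod_cast hn
  have hm : ∀ j, Measurable (fun ω => h (X j ω)) := fun j => hh.comp (hmeas j)
  have hL : ∀ j, MemLp (fun ω => h (X j ω)) 2 P := fun j =>
    MemLp.of_bound (hm j).aestronglyMeasurable 1 (Eventually.of_forall fun ω => hb _)
  have hid : ∀ j, IdentDistrib (fun ω => h (X j ω)) (fun ω => h (X 0 ω)) P P :=
    fun j => (hident j).comp hh
  set S : Ω → ℝ := ∑ j ∈ Finset.range n, fun ω => h (X j ω) with hS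
  have hSL : MemLp S 2 P := memLp_finsetSum' _ fun j _ => hL j
  have hvar : Var[S; P] = n * Var[fun ω => h (X 0 ω); P] := by
    rw [hS, IndepFun.variance_sum (fun j _ => hL j)]
    · rw [Finset.sum_congr rfl (fun j _ => (hid j).variance_eq)]
      simp
    · intro i _ j _ hij
      exact (hindep.indepFun hij).comp hh hh
  have hE : ∫ ω, S ω ∂P = n * ∫ ω, h (X 0 ω) ∂P := by
    simp only [hS, Finset.sum_apply]
    rw [integral_finsetSum _ (fun j _ => (hL j).integrable (by norm_num)),
      Finset.sum_congr rfl (fun j _ => (hid j).integral_eq)]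
    simp
  have hc : 0 < √(n:ℝ) := Real.sqrt_pos.2 (by positivity)
  have key := meas_ge_le_variance_div_sq hSL (mul_pos ha hc)
  have hset : {ω | a ≤ |√n * ((∫ ω, h (X 0 ω) ∂P) - (n : ℝ)⁻¹ * ∑ j ∈ Finset.range n, h (X j ω))|}
      = {ω | a * √n ≤ |S ω - ∫ x, S x ∂P|} := by
    ext ω
    simp only [Set.mem_ofPred_eq]
    rw [hE]
    have : √(n:ℝ) * ((∫ ω, h (X 0 ω) ∂P) - (n : ℝ)⁻¹ * ∑ j ∈ Finset.range n, h (X j ω))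
        = -(S ω - n * ∫ ω, h (X 0 ω) ∂P) / √n := by
      simp only [hS, Finset.sum_apply]
      field_simp
      rw [Real.sq_sqrt (by positivity)]
      ring
    rw [this, abs_div, abs_neg, abs_of_pos hc, le_div_iff₀ hc]
  rw [hset]
  refine key.trans (ENNReal.ofReal_le_ofReal ?_)
  rw [hvar, mul_pow, Real.sq_sqrt (by positivity)]
  have hv := variance_le_expectation_sq (μ := P) (hm 0).aestronglyMeasurable
  have : (n:ℝ) * Var[fun ω => h (X 0 ω); P] / (a ^ 2 * n) = Var[fun ω => h (X 0 ω); P] / a ^ 2 := by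
    field_simp
  rw [this]
  gcongr
  exact hv

/-- Indicator of `(-∞, x]`. -/
noncomputable def auxInd (x t : ℝ) : ℝ := if t ≤ x then 1 else 0

lemma auxInd_meas (x : ℝ) : Measurable (auxInd x) :=
  Measurable.ite measurableSet_Iic measurable_const measurable_const

lemma auxInd_bound (x t : ℝ) : |auxInd x t| ≤ 1 := by
  unfold auxInd; split_ifs <;> norm_num

lemma auxInd_int {Ω : Type*} [MeasurableSpace Ω] (P : Measure Ω) [IsProbabilityMeasure P]
    (X : Ω → ℝ) (hX : Measurable X) (x : ℝ) : Integrable (fun ω => auxInd x (X ω)) P :=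
  Integrable.of_bound ((auxInd_meas x).comp hX).aestronglyMeasurable 1
    (Eventually.of_forall fun ω => auxInd_bound _ _)

lemma auxInd_integral {Ω : Type*} [MeasurableSpace Ω] (P : Measure Ω) [IsProbabilityMeasure P]
    (X : Ω → ℝ) (hX : Measurable X) (x : ℝ) :
    ∫ ω, auxInd x (X ω) ∂P = (P {ω | X ω ≤ x}).toReal := by
  have hs : MeasurableSet {ω | X ω ≤ x} := measurableSet_le hX measurable_const
  have : (fun ω => auxInd x (X ω)) = Set.indicator {ω | X ω ≤ x} (fun _ => (1 : ℝ)) := by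
    funext ω
    simp [auxInd, Set.indicator_apply]
  rw [this, integral_indicator hs]
  simp [measureReal_def]

lemma auxInd_sq_integral {Ω : Type*} [MeasurableSpace Ω] (P : Measure Ω) [IsProbabilityMeasure P]
    (X : Ω → ℝ) (hX : Measurable X) (x y : ℝ) :
    ∫ ω, (auxInd x (X ω) - auxInd y (X ω)) ^ 2 ∂P =
      |(P {ω | X ω ≤ x}).toReal - (P {ω | X ω ≤ y}).toReal| := by
  wlog hxy : x ≤ y generalizing x y
  · rw [abs_sub_comm, ← this y x (le_of_not_ge hxy)]
    congr 1; funext ω; ring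
  have hpt : ∀ t, (auxInd x t - auxInd y t) ^ 2 = auxInd y t - auxInd x t := by
    intro t
    unfold auxInd
    by_cases h1 : t ≤ x
    · simp [h1, h1.trans hxy]
    · by_cases h2 : t ≤ y <;> simp [h1, h2]
  have h1 : ∫ ω, (auxInd x (X ω) - auxInd y (X ω)) ^ 2 ∂P =
      (P {ω | X ω ≤ y}).toReal - (P {ω | X ω ≤ x}).toReal := by
    simp_rw [hpt]
    rw [integral_sub (auxInd_int P X hX y) (auxInd_int P X hX x), auxInd_integral P X hX,
      auxInd_integral P X hX]
  have h2 : 0 ≤ ∫ ω, (auxInd x (X ω) - auxInd y (X ω)) ^ 2 ∂P :=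
    integral_nonneg fun ω => sq_nonneg _
  rw [abs_sub_comm, ← h1, abs_of_nonneg h2]

lemma aux_bahadur {Ω : Type*} [MeasurableSpace Ω] (P : Measure Ω) [IsProbabilityMeasure P]
    (X : ℕ → Ω → ℝ) (hmeas : ∀ i, Measurable (X i))
    (hindep : iIndepFun X P)
    (hident : ∀ i, IdentDistrib (X i) (X 0) P P)
    (F : ℝ → ℝ) (hF : ∀ x, F x = (P {ω | X 0 ω ≤ x}).toReal)
    (p : ℝ) (hp0 : 0 < p) (hp1 : p < 1) (ξ c : ℝ) (hc : 0 < c)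
    (hd : HasDerivAt F c ξ) (hFξ : F ξ = p) (ε : ℝ) (hε : 0 < ε) :
    Tendsto (fun n : ℕ => P {ω | ε ≤ |√n * (empQuantile X n p ω - ξ) -
      √n * (p - empCDF X n ω ξ) / c|}) atTop (𝓝 0) := by
  have hmain : ∀ M : ℝ, 0 < M → ∃ t : Finset ℝ, ∀ᶠ n : ℕ in atTop,
      P {ω | ε ≤ |√n * (empQuantile X n p ω - ξ) - √n * (p - empCDF X n ω ξ) / c|} ≤
      ENNReal.ofReal (1 / (M * c) ^ 2) + ∑ y ∈ t,
        ENNReal.ofReal (|F (ξ + (√(n:ℝ))⁻¹ * y) - F ξ| / (ε / 8 * c) ^ 2) := by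
    intro M hM
    obtain ⟨t, htf, ht⟩ := Metric.totallyBounded_iff.1
      (isCompact_Icc (a := -M - ε) (b := M + ε)).totallyBounded (ε / 4) (by positivity)
    lift t to Finset ℝ using htf
    refine ⟨t, ?_⟩
    have hy : ∀ y : ℝ, Tendsto (fun n : ℕ => √(n:ℝ) * (F (ξ + (√(n:ℝ))⁻¹ * y) - p) / c) atTop
        (𝓝 y) := by
      intro y
      have hs : Tendsto (fun n : ℕ => ‖√(n:ℝ)‖) atTop atTop :=
        tendsto_norm_atTop_atTop.comp (Real.tendsto_sqrt_atTop.comp tendsto_natCast_atTop_atTop)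
      have h1 := (hd.hasFDerivAt.lim y hs).div_const c
      simp only [smul_eq_mul, hFξ] at h1
      convert h1 using 2
      simp
      field_simp
    have hyev : ∀ᶠ n : ℕ in atTop, ∀ y ∈ t,
        |√(n:ℝ) * (F (ξ + (√(n:ℝ))⁻¹ * y) - p) / c - y| < ε / 8 := by
      rw [Filter.eventually_all_finset]
      intro y _
      exact (Metric.tendsto_nhds.1 (hy y)) (ε / 8) (by positivity)
    filter_upwards [hyev, eventually_ne_atTop 0] with n hn hn0
    have hsn : 0 < √(n:ℝ) := Real.sqrt_pos.2 (by positivity)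
    have hsub : {ω | ε ≤ |√n * (empQuantile X n p ω - ξ) - √n * (p - empCDF X n ω ξ) / c|} ⊆
        {ω | M * c ≤ |√(n:ℝ) * (p - empCDF X n ω ξ)|} ∪ ⋃ y ∈ t,
        {ω | ε / 8 * c ≤ |√(n:ℝ) * ((F (ξ + (√(n:ℝ))⁻¹ * y) - F ξ) -
          (empCDF X n ω (ξ + (√(n:ℝ))⁻¹ * y) - empCDF X n ω ξ))|} := by
      intro ω hω
      simp only [Set.mem_ofPred_eq] at hω
      by_contra hcon
      simp only [Set.mem_union, Set.mem_ofPred_eq, Set.mem_iUnion, not_or, not_le, not_exists]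
        at hcon
      obtain ⟨hW, hZ⟩ := hcon
      set W := √(n:ℝ) * (p - empCDF X n ω ξ) / c with hWdef
      set V := √(n:ℝ) * (empQuantile X n p ω - ξ) with hVdef
      have hWc : √(n:ℝ) * (p - empCDF X n ω ξ) = W * c := by rw [hWdef]; field_simp
      rw [hWc, abs_mul, abs_of_pos hc, mul_lt_mul_iff_left₀ hc, abs_lt] at hW
      -- the switching relation
      have hsw : ∀ y, V ≤ y ↔ √(n:ℝ) * (p - empCDF X n ω (ξ + (√(n:ℝ))⁻¹ * y)) ≤ 0 := by
        intro y
        have h1 : V ≤ y ↔ empQuantile X n p ω ≤ ξ + (√(n:ℝ))⁻¹ * y := by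
          rw [hVdef, ← sub_le_iff_le_add', inv_mul_eq_div, le_div_iff₀' hsn]
        rw [h1, aux_switch X n hn0 p hp0 hp1]
        constructor
        · intro h
          exact mul_nonpos_of_nonneg_of_nonpos hsn.le (by linarith)
        · intro h
          by_contra! h2
          have := mul_pos hsn (sub_pos.2 h2)
          linarith
      have hfin : ∀ y ∈ t, |(√(n:ℝ) * (p - empCDF X n ω (ξ + (√(n:ℝ))⁻¹ * y))) / c + y - W|
          < ε / 4 := by
        intro y hyt
        have h1 := hZ y hyt
        have h2 := hn y hyt
        set A := √(n:ℝ) * (F (ξ + (√(n:ℝ))⁻¹ * y) - p) / c with hA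
        set B := (√(n:ℝ) * (p - empCDF X n ω (ξ + (√(n:ℝ))⁻¹ * y))) / c with hB
        have h3 : √(n:ℝ) * ((F (ξ + (√(n:ℝ))⁻¹ * y) - F ξ) -
          (empCDF X n ω (ξ + (√(n:ℝ))⁻¹ * y) - empCDF X n ω ξ)) = (A + B - W) * c := by
          rw [hA, hB, hWdef, hFξ]; field_simp; ring
        rw [h3, abs_mul, abs_of_pos hc, mul_lt_mul_iff_left₀ hc, abs_lt] at h1
        rw [abs_lt] at h2 ⊢
        constructor <;> linarith [h1.1, h1.2, h2.1, h2.2]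
      rcases le_abs.1 hω with hpos | hneg
      · have hmem : W + ε / 2 ∈ Set.Icc (-M - ε) (M + ε) := ⟨by linarith, by linarith⟩
        obtain ⟨y, hyt, hyb⟩ := Set.mem_iUnion₂.1 (ht hmem)
        rw [Metric.mem_ball, Real.dist_eq, abs_lt] at hyb
        have hVy : ¬ V ≤ y := by linarith [hyb.1, hyb.2]
        rw [hsw, not_le] at hVy
        have h1 := hfin y hyt
        rw [abs_lt] at h1
        have h2 := div_pos hVy hc
        linarith [h1.1, h1.2, hyb.1, hyb.2]
      · have hmem : W - ε / 2 ∈ Set.Icc (-M - ε) (M + ε) := ⟨by linarith, by linarith⟩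
        obtain ⟨y, hyt, hyb⟩ := Set.mem_iUnion₂.1 (ht hmem)
        rw [Metric.mem_ball, Real.dist_eq, abs_lt] at hyb
        have hVy : V ≤ y := by linarith [hyb.1, hyb.2]
        rw [hsw] at hVy
        have h1 := hfin y hyt
        rw [abs_lt] at h1
        have h2 := div_nonpos_of_nonpos_of_nonneg hVy hc.le
        linarith [h1.1, h1.2, hyb.1, hyb.2]
    refine (measure_mono hsub).trans ((measure_union_le _ _).trans (add_le_add ?_ ?_))
    · have h1 := aux_cheb P X hmeas hindep hident (auxInd ξ) (auxInd_meas ξ) (auxInd_bound ξ) n hn0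
        (M * c) (by positivity)
      rw [auxInd_integral P _ (hmeas 0), ← hF, hFξ] at h1
      refine h1.trans (ENNReal.ofReal_le_ofReal ?_)
      gcongr
      refine (integral_mono_of_nonneg (Eventually.of_forall fun ω => sq_nonneg _)
        (integrable_const 1) (Eventually.of_forall fun ω => ?_)).trans (by simp)
      have := auxInd_bound ξ (X 0 ω)
      simp only
      rw [sq_le_one_iff_abs_le_one]
      exact this
    · refine (measure_biUnion_finset_le _ _).trans (Finset.sum_le_sum fun y _ => ?_)
      have h1 := aux_cheb P X hmeas hindep hident
        (fun s => auxInd (ξ + (√(n:ℝ))⁻¹ * y) s - auxInd ξ s)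
        ((auxInd_meas _).sub (auxInd_meas _)) (fun s => by
          unfold auxInd; split_ifs <;> norm_num) n hn0 (ε / 8 * c) (by positivity)
      rw [auxInd_sq_integral P _ (hmeas 0), integral_sub (auxInd_int P _ (hmeas 0) _)
        (auxInd_int P _ (hmeas 0) _), auxInd_integral P _ (hmeas 0), auxInd_integral P _ (hmeas 0),
        ← hF, ← hF] at h1
      simp_rw [Finset.sum_sub_distrib, mul_sub (n:ℝ)⁻¹] at h1
      exact h1
  have hcont : ∀ y : ℝ, Tendsto (fun n : ℕ =>
      ENNReal.ofReal (|F (ξ + (√(n:ℝ))⁻¹ * y) - F ξ| / (ε / 8 * c) ^ 2)) atTop (𝓝 0) := by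
    intro y
    have h0 : Tendsto (fun n : ℕ => ξ + (√(n:ℝ))⁻¹ * y) atTop (𝓝 ξ) := by
      have : Tendsto (fun n : ℕ => (√(n:ℝ))⁻¹) atTop (𝓝 0) :=
        tendsto_inv_atTop_zero.comp (Real.tendsto_sqrt_atTop.comp tendsto_natCast_atTop_atTop)
      simpa using (this.mul_const y).const_add ξ
    have h1 := hd.continuousAt.tendsto.comp h0
    have h2 := ((h1.sub_const (F ξ)).abs).div_const ((ε / 8 * c) ^ 2)
    simpa using ENNReal.tendsto_ofReal h2
  rw [ENNReal.tendsto_nhds_zero]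
  intro δ hδ
  have hδ2 : 0 < δ / 2 := ENNReal.half_pos hδ.ne'
  have hMlim : Tendsto (fun M : ℝ => ENNReal.ofReal (1 / (M * c) ^ 2)) atTop (𝓝 0) := by
    have h1 : Tendsto (fun M : ℝ => (M * c) ^ 2) atTop atTop :=
      (tendsto_pow_atTop two_ne_zero).comp (tendsto_id.atTop_mul_const hc)
    simpa using ENNReal.tendsto_ofReal (tendsto_inv_atTop_zero.comp h1)
  obtain ⟨M, hM, hM0⟩ :=
    ((ENNReal.tendsto_nhds_zero.1 hMlim _ hδ2).and (eventually_gt_atTop 0)).exists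
  obtain ⟨t, ht⟩ := hmain M hM0
  have hsum := tendsto_finsetSum t (fun y _ => hcont y)
  rw [Finset.sum_const_zero] at hsum
  filter_upwards [ht, ENNReal.tendsto_nhds_zero.1 hsum _ hδ2] with n h1 h2
  exact h1.trans ((add_le_add hM h2).trans (ENNReal.add_halves δ).le)

lemma aux_charFun_lin {k : ℕ} (m : Measure (EuclideanSpace ℝ (Fin k))) (a : Fin k → ℝ) (s : ℝ) :
    charFun (m.map (fun x : EuclideanSpace ℝ (Fin k) => ∑ i, a i * x i)) s =
      charFun m (WithLp.toLp 2 (fun i => s * a i)) := by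
  rw [charFun_apply_real, charFun_apply, integral_map]
  · congr 1
    funext x
    congr 2
    rw [← Complex.ofReal_mul]
    congr 1
    rw [PiLp.inner_apply, Finset.mul_sum]
    refine Finset.sum_congr rfl fun i _ => ?_
    simp
    ring
  · exact Measurable.aemeasurable (by fun_prop)
  · exact Continuous.aestronglyMeasurable (by fun_prop)

lemma aux_var {Ω : Type*} [MeasurableSpace Ω] (P : Measure Ω) [IsProbabilityMeasure P]
    (X : Ω → ℝ) (hX : Measurable X)
    (F : ℝ → ℝ) (hF : ∀ x, F x = (P {ω | X ω ≤ x}).toReal)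
    (k : ℕ) (p : Fin k → ℝ) (hpmono : StrictMono p)
    (ξ : Fin k → ℝ) (hFξ : ∀ i, F (ξ i) = p i)
    (c : Fin k → ℝ) (Sig : Fin k → Fin k → ℝ)
    (hSig : ∀ i j, Sig i j =
      if i ≤ j then p i * (1 - p j) / (c i * c j)
      else p j * (1 - p i) / (c i * c j)) (a : Fin k → ℝ) :
    Var[fun ω => ∑ i, (-(a i / c i)) * auxInd (ξ i) (X ω); P] = ∑ i, ∑ j, a i * a j * Sig i j := by
  have hL : ∀ x, MemLp (fun ω => auxInd x (X ω)) 2 P := fun x =>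
    MemLp.of_bound ((auxInd_meas x).comp hX).aestronglyMeasurable 1
      (Eventually.of_forall fun ω => auxInd_bound _ _)
  have hmono : Monotone F := by
    intro x y hxy
    rw [hF, hF]
    exact ENNReal.toReal_mono (measure_ne_top _ _) (measure_mono fun ω h => le_trans h hxy)
  rw [variance_fun_sum (fun i => (hL (ξ i)).const_mul _)]
  refine Finset.sum_congr rfl fun i _ => Finset.sum_congr rfl fun j _ => ?_
  rw [covariance_const_mul_left, covariance_const_mul_right, covariance_eq_sub (hL _) (hL _)]
  have hprod : ((fun ω => auxInd (ξ i) (X ω)) * fun ω => auxInd (ξ j) (X ω)) =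
      fun ω => auxInd (min (ξ i) (ξ j)) (X ω) := by
    funext ω
    simp only [Pi.mul_apply, auxInd, le_min_iff]
    by_cases h1 : X ω ≤ ξ i <;> by_cases h2 : X ω ≤ ξ j <;> simp [h1, h2]
  rw [hprod, auxInd_integral P X hX, auxInd_integral P X hX, auxInd_integral P X hX, ← hF, ← hF,
    ← hF, hmono.map_min, hFξ, hFξ, hSig]
  split_ifs with h
  · rw [min_eq_left (hpmono.monotone h)]
    simp only [div_eq_mul_inv, mul_inv]
    ring
  · rw [min_eq_right (hpmono.monotone (le_of_not_ge h))]
    simp only [div_eq_mul_inv, mul_inv]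
    ring

lemma aux_lin_clt {Ω : Type*} [MeasurableSpace Ω] (P : Measure Ω) [IsProbabilityMeasure P]
    (X : ℕ → Ω → ℝ) (hmeas : ∀ i, Measurable (X i))
    (hindep : iIndepFun X P)
    (hident : ∀ i, IdentDistrib (X i) (X 0) P P)
    (F : ℝ → ℝ) (hF : ∀ x, F x = (P {ω | X 0 ω ≤ x}).toReal)
    (k : ℕ) (p : Fin k → ℝ) (hpmono : StrictMono p)
    (ξ : Fin k → ℝ) (hFξ : ∀ i, F (ξ i) = p i)
    (c : Fin k → ℝ) (Sig : Fin k → Fin k → ℝ)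
    (hSig : ∀ i j, Sig i j =
      if i ≤ j then p i * (1 - p j) / (c i * c j)
      else p j * (1 - p i) / (c i * c j)) (a : Fin k → ℝ) :
    TendstoInDistribution
      (fun (n : ℕ) ω => ∑ i, a i * (√n * (p i - empCDF X n ω (ξ i)) / c i)) atTop id (fun _ => P)
      (gaussianReal 0 (Real.toNNReal (∑ i, ∑ j, a i * a j * Sig i j))) := by
  set h : ℝ → ℝ := fun t => ∑ i, (-(a i / c i)) * auxInd (ξ i) t with hh
  have hhm : Measurable h :=
    Finset.measurable_fun_sum _ fun i _ => (auxInd_meas (ξ i)).const_mul _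
  have hvar := aux_var P (X 0) (hmeas 0) F hF k p hpmono ξ hFξ c Sig hSig a
  have hL : MemLp (fun ω => h (X 0 ω)) 2 P := by
    refine memLp_finsetSum _ fun i _ => MemLp.const_mul ?_ _
    exact MemLp.of_bound ((auxInd_meas _).comp (hmeas 0)).aestronglyMeasurable 1
      (Eventually.of_forall fun ω => auxInd_bound _ _)
  have hE : ∫ ω, h (X 0 ω) ∂P = ∑ i, (-(a i / c i)) * p i := by
    simp only [hh]
    rw [integral_finsetSum _ (fun i _ => (auxInd_int P _ (hmeas 0) _).const_mul _)]
    refine Finset.sum_congr rfl fun i _ => ?_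
    rw [integral_const_mul, auxInd_integral P _ (hmeas 0), ← hF, hFξ]
  have hlaw : HasLaw (id : ℝ → ℝ) (gaussianReal 0 Var[fun ω => h (X 0 ω); P].toNNReal)
      (gaussianReal 0 (Real.toNNReal (∑ i, ∑ j, a i * a j * Sig i j))) := by
    rw [hvar]
    exact HasLaw.id
  have key := tendstoInDistribution_inv_sqrt_mul_sum_sub (X := fun j ω => h (X j ω)) hlaw hL
    (hindep.comp (fun _ => h) (fun _ => hhm)) (fun j => (hident j).comp hhm)
  convert key using 3 with n ω
  rw [hE]
  rcases eq_or_ne n 0 with rfl | hn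
  · simp
  have hn' : (n : ℝ) ≠ 0 := by exact_mod_cast hn
  have hsn : √(n:ℝ) ≠ 0 := (Real.sqrt_pos.2 (by positivity)).ne'
  simp only [hh]
  rw [Finset.sum_comm, Finset.mul_sum, ← Finset.sum_sub_distrib, Finset.mul_sum]
  refine Finset.sum_congr rfl fun i _ => ?_
  rw [← Finset.mul_sum]
  have : empCDF X n ω (ξ i) = (n : ℝ)⁻¹ * ∑ j ∈ Finset.range n, auxInd (ξ i) (X j ω) := rfl
  rw [this]
  set T := ∑ j ∈ Finset.range n, auxInd (ξ i) (X j ω)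
  have h2 : (√(n:ℝ))⁻¹ = √(n:ℝ) * (n:ℝ)⁻¹ := by
    field_simp
    rw [Real.sq_sqrt (by positivity)]
  rw [h2]
  simp only [div_eq_mul_inv]
  field_simp
  ring

lemma aux_vec_clt {Ω : Type*} [MeasurableSpace Ω] (P : Measure Ω) [IsProbabilityMeasure P]
    (X : ℕ → Ω → ℝ) (hmeas : ∀ i, Measurable (X i))
    (hindep : iIndepFun X P)
    (hident : ∀ i, IdentDistrib (X i) (X 0) P P)
    (F : ℝ → ℝ) (hF : ∀ x, F x = (P {ω | X 0 ω ≤ x}).toReal)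
    (k : ℕ) (p : Fin k → ℝ) (hpmono : StrictMono p)
    (ξ : Fin k → ℝ) (hFξ : ∀ i, F (ξ i) = p i)
    (c : Fin k → ℝ) (Sig : Fin k → Fin k → ℝ)
    (hSig : ∀ i j, Sig i j =
      if i ≤ j then p i * (1 - p j) / (c i * c j)
      else p j * (1 - p i) / (c i * c j)) 
    (ν : Measure (EuclideanSpace ℝ (Fin k))) [IsProbabilityMeasure ν]
    (hν : ∀ a : Fin k → ℝ, ν.map (fun x : EuclideanSpace ℝ (Fin k) => ∑ i, a i * x i) =
          gaussianReal 0 (Real.toNNReal (∑ i, ∑ j, a i * a j * Sig i j))) :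
    TendstoInDistribution
      (fun (n : ℕ) ω => WithLp.toLp 2 (fun i => √n * (p i - empCDF X n ω (ξ i)) / c i))
      atTop (id : EuclideanSpace ℝ (Fin k) → _) (fun _ => P) ν := by
  have hWm : ∀ n : ℕ, Measurable (fun ω => (WithLp.toLp 2
      (fun i => √n * (p i - empCDF X n ω (ξ i)) / c i) : EuclideanSpace ℝ (Fin k))) := by
    intro n
    refine (WithLp.measurable_toLp 2 (Fin k → ℝ)).comp (measurable_pi_lambda _ fun i => ?_)
    exact ((measurable_const.sub (aux_empCDF_meas X hmeas n (ξ i))).const_mul _).div_const _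
  refine ⟨fun n => (hWm n).aemeasurable, aemeasurable_id, ?_⟩
  refine ProbabilityMeasure.tendsto_iff_tendsto_charFun.2 fun t => ?_
  have key := (aux_lin_clt P X hmeas hindep hident F hF k p hpmono ξ hFξ c Sig hSig t).tendsto
  have key2 := ProbabilityMeasure.tendsto_iff_tendsto_charFun.1 key 1
  simp only [ProbabilityMeasure.coe_mk, Measure.map_id] at key2 ⊢
  rw [← hν t, aux_charFun_lin] at key2
  have hcongr : ∀ n : ℕ, charFun (P.map (fun ω => (WithLp.toLp 2
      (fun i => √n * (p i - empCDF X n ω (ξ i)) / c i) : EuclideanSpace ℝ (Fin k)))) t =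
      charFun (P.map (fun ω => ∑ i, t i * (√n * (p i - empCDF X n ω (ξ i)) / c i))) 1 := by
    intro n
    have h1 : P.map (fun ω => ∑ i, t i * (√n * (p i - empCDF X n ω (ξ i)) / c i)) =
      (P.map (fun ω => (WithLp.toLp 2
      (fun i => √n * (p i - empCDF X n ω (ξ i)) / c i) : EuclideanSpace ℝ (Fin k)))).map
        (fun x => ∑ i, t i * x i) := by
      rw [Measure.map_map (by fun_prop) (hWm n)]
      rfl
    rw [h1, aux_charFun_lin]
    simp
  simp_rw [hcongr]
  simpa using key2

lemma aux_gauss {k : ℕ} (Sig : Fin k → Fin k → ℝ) (hsymm : ∀ i j, Sig i j = Sig j i)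
    (hpos : ∀ a : Fin k → ℝ, 0 ≤ ∑ i, ∑ j, a i * a j * Sig i j) (a : Fin k → ℝ) :
    (multivariateGaussian 0 (Matrix.of Sig)).map
      (fun x : EuclideanSpace ℝ (Fin k) => ∑ i, a i * x i) =
          gaussianReal 0 (Real.toNNReal (∑ i, ∑ j, a i * a j * Sig i j)) := by
  have hquad : ∀ b : Fin k → ℝ, b ⬝ᵥ (Matrix.of Sig).mulVec b = ∑ i, ∑ j, b i * b j * Sig i j := by
    intro b
    simp only [dotProduct, Matrix.mulVec, Matrix.of_apply, Finset.mul_sum]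
    refine Finset.sum_congr rfl fun i _ => Finset.sum_congr rfl fun j _ => ?_
    ring
  have hS : (Matrix.of Sig).PosSemidef := by
    refine Matrix.PosSemidef.of_dotProduct_mulVec_nonneg ?_ fun b => ?_
    · ext i j
      simp [Matrix.conjTranspose_apply, hsymm j i]
    · rw [star_trivial, hquad]
      exact hpos b
  have : IsProbabilityMeasure ((multivariateGaussian 0 (Matrix.of Sig)).map
      (fun x : EuclideanSpace ℝ (Fin k) => ∑ i, a i * x i)) :=
    Measure.isProbabilityMeasure_map (Measurable.aemeasurable (by fun_prop))
  refine Measure.ext_of_charFun ?_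
  funext s
  rw [aux_charFun_lin, charFun_multivariateGaussian hS, charFun_gaussianReal]
  simp only [hquad, inner_zero_right]
  rw [Real.coe_toNNReal _ (hpos a)]
  have : ∑ i, ∑ j, s * a i * (s * a j) * Sig i j = s ^ 2 * ∑ i, ∑ j, a i * a j * Sig i j := by
    simp only [Finset.mul_sum]
    refine Finset.sum_congr rfl fun i _ => Finset.sum_congr rfl fun j _ => ?_
    ring
  rw [this]
  congr 1
  push_cast
  ring

/-- Joint asymptotic normality of several empirical quantiles (Serfling, Theorem 2.3.3B).
The limiting centered `k`-dimensional Gaussian with covariance `Sig` is characterized by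
the Cramér–Wold property: every linear functional pushes it forward to a centered
one-dimensional Gaussian with variance `aᵀ Sig a`. -/
theorem empQuantiles_joint_asymptotic_normality
    {Ω : Type*} [MeasurableSpace Ω] (P : Measure Ω) [IsProbabilityMeasure P]
    (X : ℕ → Ω → ℝ) (hmeas : ∀ i, Measurable (X i))
    (hindep : iIndepFun X P)
    (hident : ∀ i, IdentDistrib (X i) (X 0) P P)
    (F f : ℝ → ℝ) (hF : ∀ x, F x = (P {ω | X 0 ω ≤ x}).toReal)
    (k : ℕ) (p : Fin k → ℝ) (hp0 : ∀ i, 0 < p i) (hp1 : ∀ i, p i < 1)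
    (hpmono : StrictMono p)
    (ξ : Fin k → ℝ) (hξ : ∀ i, ξ i = quantileOf F (p i))
    (hdens : ∀ i, ∃ U ∈ 𝓝 (ξ i), ∀ x ∈ U, F x = ∫ s in Set.Iic x, f s)
    (hfpos : ∀ i, 0 < f (ξ i)) (hfcont : ∀ i, ContinuousAt f (ξ i))
    (Sig : Fin k → Fin k → ℝ)
    (hSig : ∀ i j, Sig i j =
      if i ≤ j then p i * (1 - p j) / (f (ξ i) * f (ξ j))
      else p j * (1 - p i) / (f (ξ i) * f (ξ j))) :
    ∃ μ : Measure (Fin k → ℝ), IsProbabilityMeasure μ ∧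
      (∀ g : BoundedContinuousFunction (Fin k → ℝ) ℝ,
        Tendsto
          (fun n : ℕ =>
            ∫ ω, g (fun i => Real.sqrt n * (empQuantile X n (p i) ω - ξ i)) ∂P)
          atTop (𝓝 (∫ x, g x ∂μ))) ∧
      (∀ a : Fin k → ℝ,
        μ.map (fun x => ∑ i, a i * x i) =
          gaussianReal 0 (Real.toNNReal (∑ i, ∑ j, a i * a j * Sig i j))) := by
  have hder : ∀ i, HasDerivAt F (f (ξ i)) (ξ i) ∧ F (ξ i) = p i := fun i =>
    aux_deriv P (X 0) (hmeas 0) F f hF (p i) (hp0 i) (hp1 i) (ξ i) (hξ i) (hdens i) (hfcont i)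
  have hFξ : ∀ i, F (ξ i) = p i := fun i => (hder i).2
  set c : Fin k → ℝ := fun i => f (ξ i) with hc
  have hpos : ∀ a : Fin k → ℝ, 0 ≤ ∑ i, ∑ j, a i * a j * Sig i j := by
    intro a
    rw [← aux_var P (X 0) (hmeas 0) F hF k p hpmono ξ hFξ c Sig hSig a]
    exact variance_nonneg _ _
  have hsymm : ∀ i j, Sig i j = Sig j i := by
    intro i j
    rw [hSig, hSig]
    rcases lt_trichotomy i j with h | h | h
    · rw [if_pos h.le, if_neg (not_le.2 h), mul_comm (f (ξ i))]
    · subst h; rfl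
    · rw [if_neg (not_le.2 h), if_pos h.le, mul_comm (f (ξ i))]
  set ν := multivariateGaussian (0 : EuclideanSpace ℝ (Fin k)) (Matrix.of Sig) with hνdef
  have hν : ∀ a : Fin k → ℝ, ν.map (fun x : EuclideanSpace ℝ (Fin k) => ∑ i, a i * x i) =
          gaussianReal 0 (Real.toNNReal (∑ i, ∑ j, a i * a j * Sig i j)) :=
    aux_gauss Sig hsymm hpos
  have hvec := aux_vec_clt P X hmeas hindep hident F hF k p hpmono ξ hFξ c Sig hSig ν hν
  have hvec2 := hvec.continuous_comp (g := (WithLp.ofLp : EuclideanSpace ℝ (Fin k) → Fin k → ℝ))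
    (PiLp.continuous_ofLp 2 _)
  have hVm : ∀ n : ℕ, Measurable
      (fun ω => fun i => Real.sqrt n * (empQuantile X n (p i) ω - ξ i)) := by
    intro n
    refine measurable_pi_lambda _ fun i => ?_
    exact ((aux_empQuantile_meas X hmeas n (p i) (hp0 i) (hp1 i)).sub_const _).const_mul _
  have hlim := tendstoInDistribution_of_tendstoInMeasure_sub
    (fun (n : ℕ) ω => fun i => Real.sqrt n * (empQuantile X n (p i) ω - ξ i)) _ hvec2 ?_
    (fun n => (hVm n).aemeasurable)
  · refine ⟨ν.map WithLp.ofLp, Measure.isProbabilityMeasure_map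
      (Measurable.aemeasurable (WithLp.measurable_ofLp 2 _)), ?_, ?_⟩
    · intro g
      have h1 := (ProbabilityMeasure.tendsto_iff_forall_integral_tendsto.1 hlim.tendsto) g
      simp only [ProbabilityMeasure.coe_mk] at h1
      refine h1.congr fun n => ?_
      rw [integral_map (hVm n).aemeasurable g.continuous.aestronglyMeasurable]
    · intro a
      rw [← hν a, Measure.map_map (by fun_prop) (WithLp.measurable_ofLp 2 _)]
      rfl
  · rw [tendstoInMeasure_iff_norm]
    intro ε hε
    have hsum := tendsto_finsetSum (Finset.univ : Finset (Fin k)) (fun i _ =>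
      aux_bahadur P X hmeas hindep hident F hF (p i) (hp0 i) (hp1 i) (ξ i) (c i) (hfpos i)
        (hder i).1 (hFξ i) ε hε)
    rw [Finset.sum_const_zero] at hsum
    refine tendsto_of_tendsto_of_tendsto_of_le_of_le tendsto_const_nhds hsum
      (fun _ => zero_le) fun n => ?_
    refine (measure_mono ?_).trans (measure_biUnion_finset_le _ _)
    intro ω hω
    simp only [Set.mem_ofPred_eq] at hω
    by_contra hcon
    simp only [Set.mem_iUnion, Set.mem_ofPred_eq, not_exists, not_le] at hcon
    refine absurd hω (not_le.2 ?_)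
    rw [pi_norm_lt_iff hε]
    intro i
    have := hcon i (Finset.mem_univ i)
    simpa using this
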